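/- Consider Algorithm 1 run on an n-vertex graph G with maximum degree Δ. Then E[ Σ_{v ∈ V} B(v) ] ≤ C·n·Δ^{1.15} for a universal constant C, where the expectation is over χ, L, π and B(v) denotes the number of entries of x⃗ (the indicator vector of V_1) queried during the execution of DegreeOracle_π(v, x⃗). -/

import Mathlib

open Finset
open scoped Classical

section Defs

private lemma sym2_exists_mem {V : Type*} (e : Sym2 V) : ∃ a, a ∈ e :=
  ⟨(Quot.out e).1, Sym2.out_fst_mem e⟩

variable {V : Type*} [Fintype V] [DecidableEq V]

/-- The greedy maximal matching of the graph with edge set `E`, processing edges in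
increasing order of the priority function `ρ`: repeatedly pick the minimum-priority
remaining edge, add it to the matching, and discard all edges meeting it. -/
noncomputable def greedyMM {β : Type*} [LinearOrder β] (ρ : Sym2 V → β) (E : Finset (Sym2 V)) :
    Finset (Sym2 V) :=
  if h : E.Nonempty then
    insert (Classical.choose (E.exists_min_image ρ h))
      (greedyMM ρ (E.filter fun f =>
        ¬ ∃ v, v ∈ Classical.choose (E.exists_min_image ρ h) ∧ v ∈ f))
  else ∅
termination_by E.card
decreasing_by
  have he : Classical.choose (E.exists_min_image ρ h) ∈ E :=
    (Classical.choose_spec (E.exists_min_image ρ h)).1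
  apply Finset.card_lt_card
  refine (Finset.ssubset_iff_of_subset (Finset.filter_subset _ _)).2 ⟨_, he, ?_⟩
  intro hmem
  obtain ⟨a, ha⟩ := sym2_exists_mem (Classical.choose (E.exists_min_image ρ h))
  exact (Finset.mem_filter.1 hmem).2 ⟨a, ha, ha⟩

/-- The set of vertices matched by a set `M` of edges. -/
noncomputable def matchedV (M : Finset (Sym2 V)) : Finset V :=
  Finset.univ.filter fun v => ∃ e ∈ M, v ∈ e

/-- Residual degree of `v` with respect to the matching `M` in the graph with edge set `E`:
`0` if `v` is matched, and otherwise the degree of `v` in the induced subgraph on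
unmatched vertices. -/
noncomputable def resDeg (E M : Finset (Sym2 V)) (v : V) : ℕ :=
  if v ∈ matchedV M then 0
  else (E.filter fun e => v ∈ e ∧ ∀ w ∈ e, w ∉ matchedV M).card

/-- The number of vertices whose match-status differs between `M` and `M'`. -/
noncomputable def statusDiff (M M' : Finset (Sym2 V)) : ℕ :=
  (Finset.univ.filter fun v => ¬ (v ∈ matchedV M ↔ v ∈ matchedV M')).card


/-- The endpoints of an edge, as a finset. -/
noncomputable def ends (e : Sym2 V) : Finset V := Finset.univ.filter (· ∈ e)

/-- The recursive edge oracle (with bookkeeping), for the graph with (sampled) edge set `L`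
and priorities `π`, run with the partition-indicator vector `x`.
`eoQ π L x fuel e` returns a triple `(ans, qs, cnt)` where `ans` tells whether `e` joins the
greedy matching of the induced subgraph of `L` on `{v | x v}`, `qs` is the set of entries of
`x` queried, and `cnt` is the number of (recursive) oracle calls made on edges of `L` having
both endpoints in `{v | x v}` (including the call on `e` itself, when applicable).
The oracle first queries the two endpoints of `e` and answers NO if one of them is outside
the part; otherwise it recursively evaluates the incident edges of `L` of smaller priority,
in increasing order of priority, stopping as soon as one of them answers YES.
It is always invoked with `fuel = π e + 1`, which guarantees the fuel never runs out. -/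
noncomputable def eoQ (π : Sym2 V → ℕ) (L : Finset (Sym2 V)) (x : V → Bool) :
    ℕ → Sym2 V → Bool × Finset V × ℕ
  | 0, e => (false, ends e, 0)
  | fuel + 1, e =>
    if ∀ v ∈ e, x v then
      let nbrs := ((L.filter fun f => f ≠ e ∧ (∃ v, v ∈ e ∧ v ∈ f) ∧ π f < π e).toList.mergeSort
          (fun a b => decide (π a ≤ π b)))
      let r := nbrs.foldl (fun (s : Bool × Finset V × ℕ) f =>
          if s.1 then s
          else
            let t := eoQ π L x fuel f
            (t.1, s.2.1 ∪ t.2.1, s.2.2 + t.2.2)) (false, ∅, 0)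
      (!r.1, ends e ∪ r.2.1, (if e ∈ L then 1 else 0) + r.2.2)
    else (false, ends e, 0)

/-- Whether `e` belongs to the greedy matching, as decided by the edge oracle. -/
noncomputable def edgeOracle (π : Sym2 V → ℕ) (L : Finset (Sym2 V)) (x : V → Bool)
    (e : Sym2 V) : Bool × Finset V × ℕ :=
  eoQ π L x (π e + 1) e

/-- The degree oracle for vertex `v`: determines `Z_{v,1}`, the number of neighbors of `v`
(in the graph with edge set `Ed`) lying in the part `{u | x u}` that are unmatched in the
greedy matching of the induced subgraph of `L`.  For each neighbor `u` of `v` it queries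
`x u`, and if `x u = 1`, it runs the edge oracle on every edge of `L` incident to `u`.
Returns `(Z value, set of entries of x queried, number of oracle calls on edges inside the part)`. -/
noncomputable def degOr (Ed : Finset (Sym2 V)) (π : Sym2 V → ℕ) (L : Finset (Sym2 V))
    (x : V → Bool) (v : V) : ℕ × Finset V × ℕ :=
  let Nv := Finset.univ.filter fun u => s(u, v) ∈ Ed
  let q := Nv ∪ (Nv.filter fun u => x u).biUnion fun u =>
      (Finset.univ.filter fun w => s(u, w) ∈ L).biUnion fun w =>
        (edgeOracle π L x s(u, w)).2.1
  let c := ∑ u ∈ Nv.filter (fun u => x u), ∑ w ∈ Finset.univ.filter (fun w => s(u, w) ∈ L),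
        (edgeOracle π L x s(u, w)).2.2
  ((Nv.filter fun u => x u ∧ ∀ w ∈ Finset.univ.filter (fun w => s(u, w) ∈ L),
      (edgeOracle π L x s(u, w)).1 = false).card, q, c)

/-- `B v`: the number of entries of `x` queried during the execution of the degree oracle. -/
noncomputable def Bqueries (Ed : Finset (Sym2 V)) (π : Sym2 V → ℕ) (L : Finset (Sym2 V))
    (x : V → Bool) (v : V) : ℕ :=
  (degOr Ed π L x v).2.1.card

/-- The priority function on edges induced by a permutation `τ` of `Fin E.card`,
via the canonical enumeration of `E`; edges outside `E` get priority `0`. -/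
noncomputable def prioOf (E : Finset (Sym2 V)) (τ : Equiv.Perm (Fin E.card)) (e : Sym2 V) : ℕ :=
  if h : e ∈ E then (τ (E.equivFin ⟨e, h⟩) : ℕ) else 0

/-- `L₁`: the set of edges of `L` with both endpoints inside the part `{v | x v}`. -/
noncomputable def partEdges (L : Finset (Sym2 V)) (x : V → Bool) : Finset (Sym2 V) :=
  L.filter fun e => ∀ v ∈ e, x v

/-- `Z_{v,1}(x)`: the number of neighbors of `v` in the graph `Ed` lying in the part
`{u | x u}` that are unmatched in `M₁ = GreedyMM(L₁, π)`. -/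
noncomputable def Zv1 (Ed : Finset (Sym2 V)) (π : Sym2 V → ℕ) (L : Finset (Sym2 V))
    (x : V → Bool) (v : V) : ℕ :=
  (Finset.univ.filter fun u =>
    s(u, v) ∈ Ed ∧ x u ∧ u ∉ matchedV (greedyMM π (partEdges L x))).card


/-- The matching output by Algorithm 1: the union over all parts `i ∈ [k]` of the greedy
maximal matching (w.r.t. the priorities `π`) of the induced subgraph of the sampled edge
set `L` on the part `V_i = χ⁻¹(i)`. -/
noncomputable def algoMatching (π : Sym2 V → ℕ) (k : ℕ) (χ : V → Fin k)
    (L : Finset (Sym2 V)) : Finset (Sym2 V) :=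
  (Finset.univ : Finset (Fin k)).biUnion fun i =>
    greedyMM π (L.filter fun e => ∀ w ∈ e, χ w = i)

/-- `Z_{v,i}`: the number of neighbors of `v` in the graph `Ed` that lie in part `V_i`
and are unmatched in the matching `M` output by Algorithm 1. -/
noncomputable def Zvi (Ed : Finset (Sym2 V)) (π : Sym2 V → ℕ) (k : ℕ) (χ : V → Fin k)
    (L : Finset (Sym2 V)) (v : V) (i : Fin k) : ℕ :=
  (Finset.univ.filter fun u =>
    s(u, v) ∈ Ed ∧ χ u = i ∧ u ∉ matchedV (algoMatching π k χ L)).card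

/-- `Z'_v`: equal to `Z_{v, χ(v)}` if `v` is unmatched in the output `M` of Algorithm 1,
and `0` if `v` is matched in `M`. -/
noncomputable def Zself (Ed : Finset (Sym2 V)) (π : Sym2 V → ℕ) (k : ℕ) (χ : V → Fin k)
    (L : Finset (Sym2 V)) (v : V) : ℕ :=
  if v ∈ matchedV (algoMatching π k χ L) then 0 else Zvi Ed π k χ L v (χ v)

/-- The Bernoulli product weight of the edge sample `S ⊆ Ed`, each edge kept with
probability `p`. -/
noncomputable def bwE (p : ℝ) (Ed S : Finset (Sym2 V)) : ℝ :=
  p ^ S.card * (1 - p) ^ (Ed.card - S.card)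

/-- The Bernoulli product weight of the indicator vector `x : V → Bool`, each coordinate
equal to `true` independently with probability `q`. -/
noncomputable def bwX (q : ℝ) (x : V → Bool) : ℝ :=
  q ^ (Finset.univ.filter fun v => x v = true).card *
    (1 - q) ^ (Finset.univ.filter fun v => x v = false).card

end Defs

section QueryPaths

/-- One recursive call of greedy maximal independent set evaluation: `b` evaluates its
neighbour `a` after all neighbours of smaller rank turned out not to be in `A`. -/
def CallStep {α : Type*} [LinearOrder α] (adj : α → α → Prop) (H : α → Prop)
    (τ : Equiv.Perm α) (A : α → Prop) (a b : α) : Prop :=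
  H b ∧ adj b a ∧ τ a < τ b ∧ ∀ c, adj b c → τ c < τ a → ¬ A c

/-- `A` is the greedy maximal independent set of the graph `adj` restricted to `H`. -/
def IsGreedy {α : Type*} [LinearOrder α] (adj : α → α → Prop) (H : α → Prop)
    (τ : Equiv.Perm α) (A : α → Prop) : Prop :=
  ∀ a, A a ↔ H a ∧ ∀ b, adj a b → τ b < τ a → ¬ A b

/-- `w 0, …, w k` is a reversed query path for `τ`, and `σ` arises from `τ` by moving the ranks
along the path two steps towards its start, cyclically. -/
structure IsRotatedPath {α : Type*} [LinearOrder α] (adj : α → α → Prop) (H : α → Prop)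
    (τ : Equiv.Perm α) (A : α → Prop) (σ : Equiv.Perm α) (k : ℕ) (w : ℕ → α) : Prop where
  one_le : 1 ≤ k
  step : ∀ i < k, CallStep adj H τ A (w i) (w (i + 1))
  shift : ∀ i, i + 2 ≤ k → σ (w (i + 2)) = τ (w i)
  shift_one : σ (w 1) = τ (w k)
  shift_zero : σ (w 0) = τ (w (k - 1))
  shift_out : ∀ x, (∀ i ≤ k, w i ≠ x) → σ x = τ x

variable {α : Type*} [LinearOrder α] {adj : α → α → Prop} {H : α → Prop}
  {τ τ' σ : Equiv.Perm α} {A A' : α → Prop}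

lemma IsGreedy.congr_of_lt [WellFoundedLT α] (hA : IsGreedy adj H τ A)
    (hA' : IsGreedy adj H τ' A') {r : α} (h : ∀ x, τ x < r ∨ τ' x < r → τ x = τ' x) (x : α)
    (hx : τ x < r) : A x ↔ A' x := by
  induction hn : τ x using WellFoundedLT.induction generalizing x with
  | ind n ih =>
    subst hn
    rw [hA x, hA' x]
    refine and_congr_right fun _ => forall_congr' fun b => imp_congr_right fun _ => ?_
    have hxx := h x (Or.inl hx)
    constructor
    · intro h1 h2
      rw [← hxx] at h2
      have hb := h b (Or.inr (h2.trans hx))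
      rw [← hb] at h2
      rw [← ih _ h2 b (h2.trans hx) rfl]
      exact h1 h2
    · intro h1 h2
      have hb := h b (Or.inl (h2.trans hx))
      rw [ih _ h2 b (h2.trans hx) rfl]
      rw [hb, hxx] at h2
      exact h1 h2

namespace IsRotatedPath

variable {k k' : ℕ} {w w' : ℕ → α}

lemma lt (hP : IsRotatedPath adj H τ A σ k w) {i j : ℕ} (hij : i < j) (hj : j ≤ k) :
    τ (w i) < τ (w j) := by
  induction j, hij using Nat.le_induction with
  | base => exact (hP.step i (by omega)).2.2.1
  | succ j _ ih => exact (ih (by omega)).trans (hP.step j (by omega)).2.2.1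

lemma le (hP : IsRotatedPath adj H τ A σ k w) {i j : ℕ} (hij : i ≤ j) (hj : j ≤ k) :
    τ (w i) ≤ τ (w j) := by
  rcases hij.eq_or_lt with rfl | h
  · exact le_rfl
  · exact (hP.lt h hj).le

lemma lt_of_lt (hP : IsRotatedPath adj H τ A σ k w) {i j : ℕ} (hi : i ≤ k)
    (h : τ (w i) < τ (w j)) : i < j := by
  by_contra hc
  exact absurd (hP.le (not_lt.1 hc) hi) (not_le.2 h)

/-- Two rotated paths with the same rotation cannot first branch with different ranks. -/
lemma not_branch [WellFoundedLT α] (hadj : ∀ a b, adj a b → adj b a) (hA : IsGreedy adj H τ A)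
    (hA' : IsGreedy adj H τ' A')
    (hP : IsRotatedPath adj H τ A σ k w) (hP' : IsRotatedPath adj H τ' A' σ k' w')
    {j : ℕ} (hjk : j + 1 < k) (hjk' : j + 1 ≤ k') (heq : ∀ i ≤ j + 1, w i = w' i) :
    ¬ τ (w j) < τ' (w' j) := by
  intro hlt
  have hσ : σ (w (j + 2)) = τ (w j) := hP.shift j (by omega)
  have hlow : ∀ i, i + 2 ≤ j + 1 → τ (w i) = τ' (w' i) := by
    intro i hi
    rw [← hP.shift i (by omega), ← hP'.shift i (by omega), heq _ hi]
  have hbelow : ∀ x, τ x < τ (w j) ∨ τ' x < τ (w j) → τ x = τ' x := by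
    intro x hx
    by_cases hxP : ∃ i ≤ k, w i = x
    · obtain ⟨i, hi, rfl⟩ := hxP
      by_cases hij : i < j
      · rw [hlow i (by omega), heq i (by omega)]
      · by_cases hij1 : i ≤ j + 1
        · exfalso
          rcases hx with hx | hx
          · exact hij (hP.lt_of_lt hi hx)
          · rw [heq i hij1] at hx
            exact hij (hP'.lt_of_lt (by omega) (hx.trans hlt))
        · obtain ⟨i, rfl⟩ : ∃ i', i = i' + 2 := ⟨i - 2, by omega⟩
          exfalso
          rcases hx with hx | hx
          · exact hij (hP.lt_of_lt hi hx)
          · by_cases hxP' : ∃ i' ≤ k', w' i' = w (i + 2)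
            · obtain ⟨i', hi', h'⟩ := hxP'
              rw [← h'] at hx
              have := hP'.lt_of_lt hi' (hx.trans hlt)
              rw [← heq i' (by omega)] at h'
              have h3 := hP.lt (show i' < i + 2 by omega) hi
              rw [h'] at h3
              exact lt_irrefl _ h3
            · push Not at hxP'
              rw [← hP'.shift_out _ hxP', hP.shift i hi] at hx
              exact absurd (hP.le (show j ≤ i by omega) (by omega)) (not_le.2 hx)
    · push Not at hxP
      rw [← hP.shift_out x hxP] at hx ⊢
      by_cases hxP' : ∃ i ≤ k', w' i = x
      · obtain ⟨i, hi, rfl⟩ := hxP'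
        have hij : j + 2 ≤ i := by
          by_contra hc
          exact hxP i (by omega) (heq i (by omega))
        obtain ⟨i, rfl⟩ : ∃ i', i = i' + 2 := ⟨i - 2, by omega⟩
        exfalso
        rcases hx with hx | hx
        · rw [hP'.shift i hi] at hx
          exact absurd (hP'.le (show j ≤ i by omega) (by omega)) (not_le.2 (hx.trans hlt))
        · have := hP'.lt_of_lt hi (hx.trans hlt)
          omega
      · push Not at hxP'
        exact hP'.shift_out x hxP'
  have hg : τ' (w (j + 2)) = τ (w j) := by
    rw [← hσ]
    refine (hP'.shift_out _ ?_).symm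
    intro i hi h
    have hij : j + 2 ≤ i := by
      by_contra hc
      rw [← heq i (by omega)] at h
      have h3 := hP.lt (show i < j + 2 by omega) (by omega)
      rw [h] at h3
      exact lt_irrefl _ h3
    obtain ⟨i, rfl⟩ : ∃ i', i = i' + 2 := ⟨i - 2, by omega⟩
    rw [← h, hP'.shift i hi] at hσ
    have := hP'.le (show j ≤ i by omega) (by omega)
    rw [hσ] at this
    exact absurd this (not_le.2 hlt)
  obtain ⟨hH, hadj1, -, hno⟩ := hP.step (j + 1) (by omega)
  have hmem : A' (w (j + 2)) := by
    rw [hA']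
    refine ⟨hH, fun b hb hlt' hbA => ?_⟩
    rw [hg] at hlt'
    have hb1 := hbelow b (Or.inr hlt')
    rw [← hb1] at hlt'
    exact hno b hb (hlt'.trans (hP.lt (Nat.lt_succ_self j) (by omega)))
      ((hA.congr_of_lt hA' hbelow b hlt').2 hbA)
  obtain ⟨-, -, -, hno'⟩ := hP'.step j (by omega)
  refine hno' (w (j + 2)) ?_ (by rw [hg]; exact hlt) hmem
  rw [← heq _ le_rfl]
  exact hadj _ _ hadj1

/-- A rotated path ending with a given call is determined by its rotation. -/
lemma unique [WellFoundedLT α] (hadj : ∀ a b, adj a b → adj b a) (hA : IsGreedy adj H τ A)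
    (hA' : IsGreedy adj H τ' A')
    (hP : IsRotatedPath adj H τ A σ k w) (hP' : IsRotatedPath adj H τ' A' σ k' w')
    (h0 : w 0 = w' 0) (h1 : w 1 = w' 1) : τ = τ' ∧ k = k' ∧ ∀ i ≤ k, w i = w' i := by
  have hone := hP.one_le
  have hone' := hP'.one_le
  have key : ∀ j, j + 1 ≤ k → j + 1 ≤ k' → ∀ i ≤ j + 1, w i = w' i := by
    intro j
    induction j with
    | zero =>
      intro _ _ i hi
      interval_cases i
      · exact h0
      · exact h1
    | succ j ih =>
      intro hk hk' i hi
      have ih := ih (by omega) (by omega)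
      rcases Nat.lt_or_ge i (j + 2) with h | h
      · exact ih i (by omega)
      obtain rfl : i = j + 2 := by omega
      apply σ.injective
      rw [hP.shift j hk, hP'.shift j hk']
      apply le_antisymm
      · exact not_lt.1 (not_branch hadj hA' hA hP' hP (by omega) (by omega)
          fun i hi => (ih i hi).symm)
      · exact not_lt.1 (not_branch hadj hA hA' hP hP' (by omega) (by omega) ih)
  have hkk : k = k' := by
    have e := hP.shift_zero
    have e' := hP'.shift_zero
    rw [h0] at e
    rcases lt_trichotomy k k' with h | h | h
    · exfalso
      refine not_branch (j := k - 1) hadj hA' hA hP' hP (by omega) (by omega)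
        (fun i hi => (key (k - 1) (by omega) (by omega) i hi).symm) ?_
      rw [← e, e']
      exact hP'.lt (by omega) (by omega)
    · exact h
    · exfalso
      refine not_branch (j := k' - 1) hadj hA hA' hP hP' (by omega) (by omega)
        (fun i hi => key (k' - 1) (by omega) (by omega) i hi) ?_
      rw [← e', e]
      exact hP.lt (by omega) (by omega)
  subst hkk
  have hw : ∀ i ≤ k, w i = w' i := fun i hi => key (k - 1) (by omega) (by omega) i (by omega)
  refine ⟨Equiv.ext fun x => ?_, rfl, hw⟩
  by_cases hx : ∃ i ≤ k, w i = x
  · obtain ⟨i, hi, rfl⟩ := hx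
    rcases Nat.lt_or_ge k (i + 2) with h | h
    · rcases hi.eq_or_lt with rfl | hik
      · rw [← hP.shift_one, hw i le_rfl, ← hP'.shift_one, h1]
      · obtain rfl : i = k - 1 := by omega
        rw [← hP.shift_zero, hw _ hi, ← hP'.shift_zero, h0]
    · rw [← hP.shift i h, hw i hi, ← hP'.shift i h, hw _ h]
  · push Not at hx
    rw [← hP.shift_out x hx, hP'.shift_out x fun i hi => by rw [← hw i hi]; exact hx i hi]

end IsRotatedPath

/-- The reversed query paths of greedy maximal independent set evaluation. -/
noncomputable def queryPaths [Fintype α] (adj : α → α → Prop) (H : α → Prop)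
    (τ : Equiv.Perm α) (A : α → Prop) : Finset (List α) :=
  ((Finset.univ : Finset {l : List α // l.Nodup}).map (Function.Embedding.subtype _)).filter
    (List.IsChain (CallStep adj H τ A))

lemma nodup_of_isChain_callStep {l : List α} (h : l.IsChain (CallStep adj H τ A)) :
    l.Nodup := by
  have h' : l.IsChain (fun a b => τ a < τ b) := h.imp fun _ _ h => h.2.2.1
  have : IsTrans α (fun a b => τ a < τ b) := ⟨fun _ _ _ h1 h2 => h1.trans h2⟩
  exact (List.isChain_iff_pairwise.1 h').imp fun h => fun e => by simp [e] at h

lemma mem_queryPaths [Fintype α] {l : List α} :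
    l ∈ queryPaths adj H τ A ↔ l.IsChain (CallStep adj H τ A) := by
  unfold queryPaths
  rw [Finset.mem_filter]
  refine and_iff_right_of_imp fun h => ?_
  simpa using nodup_of_isChain_callStep h

lemma isRotatedPath_formPerm {a b : α} {t : List α}
    (h : (a :: b :: t).IsChain (CallStep adj H τ A)) :
    IsRotatedPath adj H τ A (τ * ((a :: b :: t).formPerm ^ 2)⁻¹) (t.length + 1)
      (fun i => (a :: b :: t).getD i a) := by
  have hn := nodup_of_isChain_callStep h
  generalize hl : a :: b :: t = l at *
  have hlen : l.length = t.length + 2 := by rw [← hl]; simp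
  have hget : ∀ i (hi : i < l.length), l.getD i a = l[i] := fun i hi =>
    List.getD_eq_getElem _ _ hi
  have hrot : ∀ i (hi : i < l.length) j (hj : j < l.length), (i + 2) % l.length = j →
      (τ * (l.formPerm ^ 2)⁻¹) l[j] = τ l[i] := by
    intro i hi j hj hij
    rw [Equiv.Perm.mul_apply]
    congr 1
    rw [Equiv.Perm.inv_eq_iff_eq, List.formPerm_pow_apply_getElem l hn 2 i hi]
    simp only [hij]
  refine ⟨by omega, ?_, ?_, ?_, ?_, ?_⟩
  · intro i hi
    rw [hget _ (by omega), hget _ (by omega)]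
    exact List.isChain_iff_getElem.1 h i (by omega)
  · intro i hi
    rw [hget _ (by omega), hget _ (by omega)]
    exact hrot _ _ _ _ (Nat.mod_eq_of_lt (by omega))
  · rw [hget _ (by omega), hget _ (by omega)]
    refine hrot _ _ _ _ ?_
    rw [hlen, show t.length + 1 + 2 = 1 + (t.length + 2) by omega, Nat.add_mod_right,
      Nat.mod_eq_of_lt (by omega)]
  · rw [hget _ (by omega), hget _ (by omega)]
    refine hrot _ _ _ _ ?_
    rw [hlen, Nat.add_sub_cancel, Nat.mod_self]
  · intro x hx
    have hxl : x ∉ l := by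
      intro hmem
      obtain ⟨i, hi, rfl⟩ := List.getElem_of_mem hmem
      exact hx i (by omega) (hget i hi)
    rw [Equiv.Perm.mul_apply]
    congr 1
    rw [Equiv.Perm.inv_eq_iff_eq]
    have := List.formPerm_apply_of_notMem hxl
    rw [pow_two, Equiv.Perm.mul_apply, this, this]

/-- Averaged over all rankings, at most one query path ends with a given call. -/
lemma sum_card_queryPaths_le [Fintype α] (hadj : ∀ a b, adj a b → adj b a)
    {A : Equiv.Perm α → α → Prop} (hA : ∀ τ, IsGreedy adj H τ (A τ)) (a b : α) :
    ∑ τ : Equiv.Perm α, #{l ∈ queryPaths adj H τ (A τ) | ∃ t, l = a :: b :: t} ≤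
      Fintype.card (Equiv.Perm α) := by
  rw [← Finset.card_sigma, ← Finset.card_univ]
  refine Finset.card_le_card_of_injOn (fun q => q.1 * (q.2.formPerm ^ 2)⁻¹)
    (fun _ _ => Finset.mem_coe.2 (Finset.mem_univ _)) ?_
  rintro ⟨τ, l⟩ hl ⟨τ', l'⟩ hl' heq
  simp only [Finset.coe_sigma, Set.mem_sigma_iff, Finset.mem_coe, Finset.mem_filter,
    mem_queryPaths] at hl hl'
  obtain ⟨-, hc, t, rfl⟩ := hl
  obtain ⟨-, hc', t', rfl⟩ := hl'
  have hP := isRotatedPath_formPerm hc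
  have hP' := isRotatedPath_formPerm hc'
  dsimp only at heq
  rw [← heq] at hP'
  obtain ⟨hτ, hlen, hw⟩ := hP.unique hadj (hA τ) (hA τ') hP' rfl rfl
  subst hτ
  have : a :: b :: t = a :: b :: t' := by
    apply List.ext_getElem
    · simpa using hlen
    · intro i hi hi'
      have := hw i (by simp at hi; omega)
      rwa [List.getD_eq_getElem _ _ hi, List.getD_eq_getElem _ _ hi'] at this
  rw [this]

end QueryPaths
section Oracle

variable {V : Type*} [DecidableEq V]

/-- The accumulation step of the edge oracle's loop over incident edges. -/
def oracleStep {β : Type*} (ev : β → Bool × Finset V × ℕ) (s : Bool × Finset V × ℕ) (f : β) :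
    Bool × Finset V × ℕ :=
  if s.1 then s else ((ev f).1, s.2.1 ∪ (ev f).2.1, s.2.2 + (ev f).2.2)

lemma foldl_oracleStep_fst {β : Type*} (ev : β → Bool × Finset V × ℕ) (l : List β)
    (s : Bool × Finset V × ℕ) :
    (l.foldl (oracleStep ev) s).1 = true ↔ s.1 = true ∨ ∃ f ∈ l, (ev f).1 = true := by
  induction l generalizing s with
  | nil => simp
  | cons a l ih =>
    rw [List.foldl_cons, ih]
    by_cases hs : s.1 = true <;> simp [oracleStep, hs]

lemma mem_foldl_oracleStep {β : Type*} (ev : β → Bool × Finset V × ℕ) (l : List β)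
    (s : Bool × Finset V × ℕ) (y : V) (hy : y ∈ (l.foldl (oracleStep ev) s).2.1) :
    y ∈ s.2.1 ∨ ∃ l₁ f l₂, l = l₁ ++ f :: l₂ ∧ (∀ g ∈ l₁, (ev g).1 = false) ∧
      s.1 = false ∧ y ∈ (ev f).2.1 := by
  induction l generalizing s with
  | nil => exact Or.inl hy
  | cons a l ih =>
    rw [List.foldl_cons] at hy
    rcases ih _ hy with h | ⟨l₁, f, l₂, rfl, h1, h2, h3⟩
    · by_cases hs : s.1 = true
      · left
        simpa [oracleStep, hs] using h
      · simp only [oracleStep, hs, Bool.false_eq_true, if_false, Finset.mem_union] at h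
        rcases h with h | h
        · exact Or.inl h
        · exact Or.inr ⟨[], a, l, rfl, by simp, by simpa using hs, h⟩
    · right
      by_cases hs : s.1 = true
      · simp [oracleStep, hs] at h2
      · simp only [oracleStep, hs, Bool.false_eq_true, if_false] at h2
        refine ⟨a :: l₁, f, l₂, rfl, ?_, by simpa using hs, h3⟩
        intro g hg
        rcases List.mem_cons.1 hg with rfl | hg
        · exact h2
        · exact h1 g hg

variable [Fintype V]

/-- The incident edges of `L` of smaller priority, in increasing order of priority. -/
noncomputable def lowerEdges (π : Sym2 V → ℕ) (L : Finset (Sym2 V)) (e : Sym2 V) :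
    List (Sym2 V) :=
  (L.filter fun f => f ≠ e ∧ (∃ v, v ∈ e ∧ v ∈ f) ∧ π f < π e).toList.mergeSort
    (fun a b => decide (π a ≤ π b))

lemma mem_lowerEdges {π : Sym2 V → ℕ} {L : Finset (Sym2 V)} {e f : Sym2 V} :
    f ∈ lowerEdges π L e ↔ f ∈ L ∧ f ≠ e ∧ (∃ v, v ∈ e ∧ v ∈ f) ∧ π f < π e := by
  simp [lowerEdges]

lemma pairwise_lowerEdges (π : Sym2 V → ℕ) (L : Finset (Sym2 V)) (e : Sym2 V) :
    (lowerEdges π L e).Pairwise (fun a b => π a ≤ π b) := by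
  have := List.pairwise_mergeSort (le := fun a b : Sym2 V => decide (π a ≤ π b))
    (fun a b c h1 h2 => by simp at *; omega) (fun a b => by simp; omega)
    (L.filter fun f => f ≠ e ∧ (∃ v, v ∈ e ∧ v ∈ f) ∧ π f < π e).toList
  exact this.imp fun h => by simpa using h

lemma eoQ_succ (π : Sym2 V → ℕ) (L : Finset (Sym2 V)) (x : V → Bool) (n : ℕ) (e : Sym2 V) :
    eoQ π L x (n + 1) e =
      if ∀ v ∈ e, x v then
        (!((lowerEdges π L e).foldl (oracleStep (eoQ π L x n)) (false, ∅, 0)).1,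
          ends e ∪ ((lowerEdges π L e).foldl (oracleStep (eoQ π L x n)) (false, ∅, 0)).2.1,
          (if e ∈ L then 1 else 0) +
            ((lowerEdges π L e).foldl (oracleStep (eoQ π L x n)) (false, ∅, 0)).2.2)
      else (false, ends e, 0) := by
  rw [eoQ]
  rfl

lemma eoQ_eq_of_lt (π : Sym2 V → ℕ) (L : Finset (Sym2 V)) (x : V → Bool) (n m : ℕ)
    (e : Sym2 V) (hn : π e < n) (hm : π e < m) : eoQ π L x n e = eoQ π L x m e := by
  induction n generalizing m e with
  | zero => omega
  | succ n ih =>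
    obtain ⟨m, rfl⟩ : ∃ m', m = m' + 1 := ⟨m - 1, by omega⟩
    have : (lowerEdges π L e).foldl (oracleStep (eoQ π L x n)) (false, ∅, 0) =
        (lowerEdges π L e).foldl (oracleStep (eoQ π L x m)) (false, ∅, 0) := by
      refine List.foldl_ext _ _ _ fun s f hf => ?_
      have hlt := (mem_lowerEdges.1 hf).2.2.2
      rw [oracleStep, oracleStep, ih m f (by omega) (by omega)]
    rw [eoQ_succ, eoQ_succ, this]

lemma edgeOracle_eq (π : Sym2 V → ℕ) (L : Finset (Sym2 V)) (x : V → Bool) (e : Sym2 V) :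
    edgeOracle π L x e =
      if ∀ v ∈ e, x v then
        (!((lowerEdges π L e).foldl (oracleStep (edgeOracle π L x)) (false, ∅, 0)).1,
          ends e ∪ ((lowerEdges π L e).foldl (oracleStep (edgeOracle π L x)) (false, ∅, 0)).2.1,
          (if e ∈ L then 1 else 0) +
            ((lowerEdges π L e).foldl (oracleStep (edgeOracle π L x)) (false, ∅, 0)).2.2)
      else (false, ends e, 0) := by
  have : (lowerEdges π L e).foldl (oracleStep (eoQ π L x (π e))) (false, ∅, 0) =
      (lowerEdges π L e).foldl (oracleStep (edgeOracle π L x)) (false, ∅, 0) := by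
    refine List.foldl_ext _ _ _ fun s f hf => ?_
    have hlt := (mem_lowerEdges.1 hf).2.2.2
    rw [oracleStep, oracleStep, edgeOracle, eoQ_eq_of_lt π L x (π e) (π f + 1) f hlt (by omega)]
  rw [edgeOracle, eoQ_succ, this]

lemma edgeOracle_fst (π : Sym2 V → ℕ) (L : Finset (Sym2 V)) (x : V → Bool) (e : Sym2 V) :
    (edgeOracle π L x e).1 = true ↔ (∀ v ∈ e, x v = true) ∧
      ∀ f ∈ L, f ≠ e → (∃ v, v ∈ e ∧ v ∈ f) → π f < π e → (edgeOracle π L x f).1 = false := by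
  rw [edgeOracle_eq]
  by_cases h : ∀ v ∈ e, x v = true
  · rw [if_pos h]
    simp only [Bool.not_eq_true', ← Bool.not_eq_true, foldl_oracleStep_fst, mem_lowerEdges]
    constructor
    · intro h1
      refine ⟨h, fun f hf hfe hv hlt hA => h1 (Or.inr ⟨f, ⟨hf, hfe, hv, hlt⟩, hA⟩)⟩
    · rintro ⟨-, h2⟩ (h3 | ⟨f, ⟨hf, hfe, hv, hlt⟩, hA⟩)
      · simp at h3
      · exact h2 f hf hfe hv hlt hA
  · rw [if_neg h]
    simp only [Bool.false_eq_true, false_iff]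
    exact fun h' => h h'.1

lemma mem_edgeOracle_queries {π : Sym2 V → ℕ} {L : Finset (Sym2 V)} {x : V → Bool}
    {e : Sym2 V} {y : V} (hy : y ∈ (edgeOracle π L x e).2.1) :
    y ∈ e ∨ ((∀ v ∈ e, x v = true) ∧ ∃ f ∈ L, f ≠ e ∧ (∃ v, v ∈ e ∧ v ∈ f) ∧ π f < π e ∧
      (∀ g ∈ L, g ≠ e → (∃ v, v ∈ e ∧ v ∈ g) → π g < π f → (edgeOracle π L x g).1 = false) ∧
      y ∈ (edgeOracle π L x f).2.1) := by
  rw [edgeOracle_eq] at hy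
  by_cases h : ∀ v ∈ e, x v = true
  · rw [if_pos h] at hy
    rcases Finset.mem_union.1 hy with hy | hy
    · left
      simpa [ends] using hy
    · right
      refine ⟨h, ?_⟩
      rcases mem_foldl_oracleStep _ _ _ _ hy with hy | ⟨l₁, f, l₂, hl, h1, -, h3⟩
      · simp at hy
      · have hf : f ∈ lowerEdges π L e := by rw [hl]; simp
        obtain ⟨hfL, hfe, hv, hlt⟩ := mem_lowerEdges.1 hf
        refine ⟨f, hfL, hfe, hv, hlt, fun g hg hge hgv hgf => ?_, h3⟩
        have hgm : g ∈ lowerEdges π L e := mem_lowerEdges.2 ⟨hg, hge, hgv, hgf.trans hlt⟩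
        have hs := pairwise_lowerEdges π L e
        rw [hl, List.pairwise_append, List.pairwise_cons] at hs
        rw [hl, List.mem_append, List.mem_cons] at hgm
        rcases hgm with hgm | rfl | hgm
        · exact h1 g hgm
        · omega
        · have := hs.2.1.1 g hgm
          omega
  · rw [if_neg h] at hy
    left
    simpa [ends] using hy

end Oracle

section EdgeIndices

variable {V : Type*}

/-- The `i`-th edge in the canonical enumeration of `E`. -/
noncomputable def edgeAt (E : Finset (Sym2 V)) (i : Fin E.card) : Sym2 V :=
  (E.equivFin.symm i).1

/-- Distinct edges sharing an endpoint. -/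
def EdgeAdj (E : Finset (Sym2 V)) (i j : Fin E.card) : Prop :=
  i ≠ j ∧ ∃ v, v ∈ edgeAt E i ∧ v ∈ edgeAt E j

/-- Sampled edges inside the part `{v | x v}`. -/
def InPart (E S : Finset (Sym2 V)) (x : V → Bool) (i : Fin E.card) : Prop :=
  edgeAt E i ∈ S ∧ ∀ v ∈ edgeAt E i, x v = true

lemma edgeAt_mem (E : Finset (Sym2 V)) (i : Fin E.card) : edgeAt E i ∈ E :=
  (E.equivFin.symm i).2

lemma edgeAt_injective (E : Finset (Sym2 V)) : Function.Injective (edgeAt E) := fun _ _ h =>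
  E.equivFin.symm.injective (Subtype.ext h)

lemma exists_edgeAt {E : Finset (Sym2 V)} {e : Sym2 V} (he : e ∈ E) : ∃ i, edgeAt E i = e :=
  ⟨E.equivFin ⟨e, he⟩, by simp [edgeAt]⟩

lemma EdgeAdj.symm {E : Finset (Sym2 V)} {i j : Fin E.card} (h : EdgeAdj E i j) :
    EdgeAdj E j i :=
  ⟨h.1.symm, h.2.imp fun _ h => h.symm⟩

variable [DecidableEq V]

lemma prioOf_edgeAt (E : Finset (Sym2 V)) (τ : Equiv.Perm (Fin E.card)) (i : Fin E.card) :
    prioOf E τ (edgeAt E i) = τ i := by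
  rw [prioOf, dif_pos (edgeAt_mem E i)]
  simp [edgeAt]

variable [Fintype V]

/-- Sampled edges on which the edge oracle answers YES. -/
def OracleYes (E S : Finset (Sym2 V)) (x : V → Bool) (τ : Equiv.Perm (Fin E.card))
    (i : Fin E.card) : Prop :=
  edgeAt E i ∈ S ∧ (edgeOracle (prioOf E τ) S x (edgeAt E i)).1 = true

lemma isGreedy_oracleYes {E S : Finset (Sym2 V)} (hS : S ⊆ E) (x : V → Bool)
    (τ : Equiv.Perm (Fin E.card)) :
    IsGreedy (EdgeAdj E) (InPart E S x) τ (OracleYes E S x τ) := by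
  intro i
  unfold OracleYes
  rw [edgeOracle_fst, InPart, and_assoc]
  refine and_congr_right fun _ => and_congr_right fun _ => ?_
  constructor
  · rintro h j ⟨hij, hv⟩ hlt ⟨hj, hA⟩
    have := h _ hj (fun h => hij (edgeAt_injective E h).symm) hv
      (by rwa [prioOf_edgeAt, prioOf_edgeAt, Fin.val_fin_lt])
    simp [this] at hA
  · intro h f hf hfe hv hlt
    obtain ⟨j, rfl⟩ := exists_edgeAt (hS hf)
    rw [prioOf_edgeAt, prioOf_edgeAt, Fin.val_fin_lt] at hlt
    have := h j ⟨fun h => hfe (by rw [h]), hv⟩ hlt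
    simpa [hf] using this

/-- Every entry queried by the edge oracle is an endpoint of the end of a query path. -/
lemma exists_queryPath {E S : Finset (Sym2 V)} (hS : S ⊆ E) (x : V → Bool)
    (τ : Equiv.Perm (Fin E.card)) (i : Fin E.card) (hi : edgeAt E i ∈ S) (y : V)
    (hy : y ∈ (edgeOracle (prioOf E τ) S x (edgeAt E i)).2.1) :
    ∃ j l, (j :: l).IsChain (CallStep (EdgeAdj E) (InPart E S x) τ (OracleYes E S x τ)) ∧
      (j :: l).getLast? = some i ∧ edgeAt E j ∈ S ∧ y ∈ edgeAt E j := by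
  induction hn : τ i using WellFoundedLT.induction generalizing i with
  | ind n ih =>
    subst hn
    rcases mem_edgeOracle_queries hy with h | ⟨hx, f, hf, hfe, hv, hlt, hno, hyf⟩
    · exact ⟨i, [], by simp, by simp, hi, h⟩
    · obtain ⟨a, rfl⟩ := exists_edgeAt (hS hf)
      rw [prioOf_edgeAt, prioOf_edgeAt, Fin.val_fin_lt] at hlt
      obtain ⟨j, l, hc, hl, hj, hyj⟩ := ih _ hlt a hf hyf rfl
      refine ⟨j, l ++ [i], ?_, by rw [← List.cons_append, List.getLast?_concat], hj, hyj⟩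
      rw [← List.cons_append, List.isChain_append]
      refine ⟨hc, List.isChain_singleton _, ?_⟩
      intro b hb c hc'
      rw [hl] at hb
      simp only [Option.mem_def, Option.some.injEq, List.head?_cons] at hb hc'
      subst hb hc'
      refine ⟨⟨hi, hx⟩, ⟨fun h => hfe (by rw [h]), hv⟩, hlt, ?_⟩
      rintro c ⟨hic, hcv⟩ hca ⟨hcS, hcA⟩
      have := hno _ hcS (fun h => hic (edgeAt_injective E h).symm) hcv
        (by rwa [prioOf_edgeAt, prioOf_edgeAt, Fin.val_fin_lt])
      simp [this] at hcA

/-- The query paths with at least one recursive call, whose final edge is sampled. -/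
noncomputable def longPaths (E S : Finset (Sym2 V)) (x : V → Bool)
    (τ : Equiv.Perm (Fin E.card)) : Finset (List (Fin E.card)) :=
  {l ∈ queryPaths (EdgeAdj E) (InPart E S x) τ (OracleYes E S x τ) |
    ∃ a b t, l = a :: b :: t ∧ edgeAt E a ∈ S}

lemma card_ends_le (e : Sym2 V) : (ends e).card ≤ 2 := by
  induction e using Sym2.ind with
  | _ a b =>
    refine (Finset.card_le_card (t := {a, b}) fun y hy => ?_).trans Finset.card_le_two
    simpa [ends] using hy

lemma card_edgeOracle_queries_le {E S : Finset (Sym2 V)} (hS : S ⊆ E) (x : V → Bool)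
    (τ : Equiv.Perm (Fin E.card)) {e : Sym2 V} (he : e ∈ S) :
    (edgeOracle (prioOf E τ) S x e).2.1.card ≤
      2 * (1 + #{l ∈ longPaths E S x τ | ∃ i, l.getLast? = some i ∧ edgeAt E i = e}) := by
  obtain ⟨i, rfl⟩ := exists_edgeAt (hS he)
  set P := {l ∈ longPaths E S x τ | ∃ j, l.getLast? = some j ∧ edgeAt E j = edgeAt E i}
  have hsub : (edgeOracle (prioOf E τ) S x (edgeAt E i)).2.1 ⊆
      (insert [i] P).biUnion fun l => l.head?.elim ∅ fun j => ends (edgeAt E j) := by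
    intro y hy
    obtain ⟨j, l, hc, hl, hj, hyj⟩ := exists_queryPath hS x τ i he y hy
    refine Finset.mem_biUnion.2 ⟨j :: l, ?_, by simpa [ends] using hyj⟩
    rw [Finset.mem_insert]
    cases l with
    | nil =>
      left
      simpa using hl
    | cons b t =>
      right
      exact Finset.mem_filter.2 ⟨Finset.mem_filter.2
        ⟨mem_queryPaths.2 hc, j, b, t, rfl, hj⟩, i, hl, rfl⟩
  calc _ ≤ _ := Finset.card_le_card hsub
    _ ≤ (insert [i] P).card * 2 := by
      refine Finset.card_biUnion_le_card_mul _ _ _ fun l _ => ?_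
      cases l with
      | nil => simp
      | cons j t => exact card_ends_le _
    _ ≤ _ := by
      have := Finset.card_insert_le [i] P
      omega

/-- Ordered pairs of adjacent sampled edges, the second of which is inside the part. -/
noncomputable def callPairs (E S : Finset (Sym2 V)) (x : V → Bool) :
    Finset (Fin E.card × Fin E.card) :=
  {q | EdgeAdj E q.1 q.2 ∧ edgeAt E q.1 ∈ S ∧ InPart E S x q.2}

lemma sum_card_longPaths_le {E S : Finset (Sym2 V)} (hS : S ⊆ E) (x : V → Bool) :
    ∑ τ : Equiv.Perm (Fin E.card), (longPaths E S x τ).card ≤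
      (callPairs E S x).card * Fintype.card (Equiv.Perm (Fin E.card)) := by
  calc ∑ τ : Equiv.Perm (Fin E.card), (longPaths E S x τ).card
      ≤ ∑ τ : Equiv.Perm (Fin E.card), ∑ q ∈ callPairs E S x,
        #{l ∈ queryPaths (EdgeAdj E) (InPart E S x) τ (OracleYes E S x τ) |
          ∃ t, l = q.1 :: q.2 :: t} := by
        refine Finset.sum_le_sum fun τ _ => ?_
        refine le_trans (Finset.card_le_card ?_) Finset.card_biUnion_le
        intro l hl
        obtain ⟨hl, a, b, t, rfl, ha⟩ := Finset.mem_filter.1 hl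
        have hc := (List.isChain_cons_cons.1 (mem_queryPaths.1 hl)).1
        exact Finset.mem_biUnion.2 ⟨(a, b), Finset.mem_filter.2
          ⟨Finset.mem_univ _, hc.2.1.symm, ha, hc.1⟩, Finset.mem_filter.2 ⟨hl, t, rfl⟩⟩
    _ = ∑ q ∈ callPairs E S x, ∑ τ : Equiv.Perm (Fin E.card),
        #{l ∈ queryPaths (EdgeAdj E) (InPart E S x) τ (OracleYes E S x τ) |
          ∃ t, l = q.1 :: q.2 :: t} := Finset.sum_comm
    _ ≤ ∑ q ∈ callPairs E S x, Fintype.card (Equiv.Perm (Fin E.card)) :=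
        Finset.sum_le_sum fun q _ => sum_card_queryPaths_le (fun _ _ => EdgeAdj.symm)
          (isGreedy_oracleYes hS x) q.1 q.2
    _ = _ := by rw [Finset.sum_const, smul_eq_mul]

/-- Sampled edges with a distinguished first endpoint, which lies inside the part. -/
noncomputable def partDarts (S : Finset (Sym2 V)) (x : V → Bool) : Finset (V × V) :=
  {q | x q.1 = true ∧ s(q.1, q.2) ∈ S}

lemma card_darts_le (D : Finset (V × V)) (e : Sym2 V) : #{q ∈ D | s(q.1, q.2) = e} ≤ 2 := by
  induction e using Sym2.ind with
  | _ a b =>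
    refine (Finset.card_le_card (t := {(a, b), (b, a)}) fun q hq => ?_).trans Finset.card_le_two
    have := (Finset.mem_filter.1 hq).2
    rw [Sym2.eq_iff] at this
    simpa [Prod.ext_iff] using this

lemma sum_card_edgeOracle_queries_le {E S : Finset (Sym2 V)} (hS : S ⊆ E) (x : V → Bool)
    (τ : Equiv.Perm (Fin E.card)) :
    ∑ q ∈ partDarts S x, (edgeOracle (prioOf E τ) S x s(q.1, q.2)).2.1.card ≤
      2 * ((partDarts S x).card + 2 * (longPaths E S x τ).card) := by
  have hswap : ∑ q ∈ partDarts S x,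
      #{l ∈ longPaths E S x τ | ∃ i, l.getLast? = some i ∧ edgeAt E i = s(q.1, q.2)} ≤
      2 * (longPaths E S x τ).card := by
    simp only [Finset.card_filter]
    rw [Finset.sum_comm, mul_comm]
    refine Finset.sum_le_card_nsmul _ _ _ fun l _ => ?_
    rw [← Finset.card_filter]
    cases hl : l.getLast? with
    | none => simp
    | some i =>
      simp only [Option.some.injEq, exists_eq_left']
      simpa only [eq_comm] using card_darts_le (partDarts S x) (edgeAt E i)
  calc _ ≤ ∑ q ∈ partDarts S x, 2 * (1 +
      #{l ∈ longPaths E S x τ | ∃ i, l.getLast? = some i ∧ edgeAt E i = s(q.1, q.2)}) :=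
        Finset.sum_le_sum fun q hq =>
          card_edgeOracle_queries_le hS x τ (Finset.mem_filter.1 hq).2.2
    _ ≤ _ := by
      rw [← Finset.mul_sum, Finset.sum_add_distrib, Finset.sum_const, smul_eq_mul, mul_one]
      omega

lemma card_neighbors_le {E : Finset (Sym2 V)} {Δ : ℕ}
    (hΔ : ∀ v : V, (E.filter fun e => v ∈ e).card ≤ Δ) (v : V) : #{u | s(u, v) ∈ E} ≤ Δ := by
  refine (Finset.card_le_card_of_injOn (fun u => s(u, v)) ?_ ?_).trans (hΔ v)
  · intro u hu
    simpa using hu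
  · intro u _ u' _ h
    exact Sym2.congr_left.1 h

lemma sum_Bqueries_le {E S : Finset (Sym2 V)} (hS : S ⊆ E) {Δ : ℕ}
    (hΔ : ∀ v : V, (E.filter fun e => v ∈ e).card ≤ Δ) (x : V → Bool)
    (τ : Equiv.Perm (Fin E.card)) :
    ∑ v, Bqueries E (prioOf E τ) S x v ≤ Fintype.card V * Δ +
      Δ * (2 * ((partDarts S x).card + 2 * (longPaths E S x τ).card)) := by
  set g : V → ℕ := fun u => ∑ w with s(u, w) ∈ S,
    (edgeOracle (prioOf E τ) S x s(u, w)).2.1.card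
  have hB : ∀ v, Bqueries E (prioOf E τ) S x v ≤
      Δ + ∑ u with x u = true, if s(u, v) ∈ E then g u else 0 := by
    intro v
    refine (Finset.card_union_le _ _).trans (add_le_add (card_neighbors_le hΔ v) ?_)
    refine Finset.card_biUnion_le.trans ?_
    rw [← Finset.sum_filter, Finset.filter_comm]
    exact Finset.sum_le_sum fun u _ => Finset.card_biUnion_le
  calc _ ≤ ∑ v, (Δ + ∑ u with x u = true, if s(u, v) ∈ E then g u else 0) :=
        Finset.sum_le_sum fun v _ => hB v
    _ = Fintype.card V * Δ + ∑ u with x u = true, #{v | s(v, u) ∈ E} * g u := by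
      rw [Finset.sum_add_distrib, Finset.sum_const, smul_eq_mul, Finset.card_univ,
        Finset.sum_comm]
      congr 1
      refine Finset.sum_congr rfl fun u _ => ?_
      rw [← Finset.sum_filter, Finset.sum_const, smul_eq_mul]
      simp only [Sym2.eq_swap]
    _ ≤ Fintype.card V * Δ + Δ * ∑ u with x u = true, g u := by
      rw [Finset.mul_sum]
      gcongr with u
      exact card_neighbors_le hΔ u
    _ ≤ _ := by
      gcongr
      refine le_trans (le_of_eq ?_) (sum_card_edgeOracle_queries_le hS x τ)
      symm
      exact Finset.sum_finset_product _ _ _ fun q => by simp [partDarts]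

end EdgeIndices

section SampleMean

variable {V : Type*} [Fintype V] [DecidableEq V]

/-- The expectation over the edge sample and the partition. -/
noncomputable def sampleMean (p : ℝ) (k : ℕ) (E : Finset (Sym2 V))
    (f : Finset (Sym2 V) → (V → Fin k) → ℝ) : ℝ :=
  ∑ S ∈ E.powerset, ∑ χ : V → Fin k, bwE p E S * ((k : ℝ) ^ Fintype.card V)⁻¹ * f S χ

variable {p : ℝ} {k : ℕ} {E : Finset (Sym2 V)}

lemma sampleMean_mono (hp0 : 0 ≤ p) (hp1 : p ≤ 1) {f g : Finset (Sym2 V) → (V → Fin k) → ℝ}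
    (h : ∀ S ⊆ E, ∀ χ, f S χ ≤ g S χ) : sampleMean p k E f ≤ sampleMean p k E g := by
  have : 0 ≤ 1 - p := by linarith
  refine Finset.sum_le_sum fun S hS => Finset.sum_le_sum fun χ _ => ?_
  have := h S (Finset.mem_powerset.1 hS) χ
  unfold bwE
  gcongr

lemma sampleMean_add (f g : Finset (Sym2 V) → (V → Fin k) → ℝ) :
    sampleMean p k E (fun S χ => f S χ + g S χ) = sampleMean p k E f + sampleMean p k E g := by
  simp only [sampleMean, mul_add, Finset.sum_add_distrib]

lemma sampleMean_const_mul (c : ℝ) (f : Finset (Sym2 V) → (V → Fin k) → ℝ) :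
    sampleMean p k E (fun S χ => c * f S χ) = c * sampleMean p k E f := by
  simp only [sampleMean, Finset.mul_sum, mul_left_comm]

lemma sampleMean_sum {ι : Type*} (s : Finset ι) (f : ι → Finset (Sym2 V) → (V → Fin k) → ℝ) :
    sampleMean p k E (fun S χ => ∑ i ∈ s, f i S χ) = ∑ i ∈ s, sampleMean p k E (f i) := by
  simp only [sampleMean, Finset.mul_sum]
  rw [Finset.sum_comm (s := s)]
  exact Finset.sum_congr rfl fun S _ => Finset.sum_comm

lemma sum_bwE_superset {T : Finset (Sym2 V)} (hT : T ⊆ E) :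
    ∑ S ∈ E.powerset with T ⊆ S, bwE p E S = p ^ T.card := by
  have h : E.powerset.filter (T ⊆ ·) = Finset.Icc T E := by
    ext S
    simp [and_comm]
  rw [h, Finset.Icc_eq_image_powerset hT, Finset.sum_image]
  · have h1 : ∀ S ∈ (E \ T).powerset, bwE p E (T ∪ S) =
        p ^ T.card * (p ^ S.card * (1 - p) ^ ((E \ T).card - S.card)) := by
      intro S hS
      have hd : Disjoint T S :=
        Finset.disjoint_of_subset_right (Finset.mem_powerset.1 hS) Finset.disjoint_sdiff
      rw [bwE, Finset.card_union_of_disjoint hd, pow_add, Finset.card_sdiff_of_subset hT,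
        Nat.sub_add_eq, mul_assoc]
    rw [Finset.sum_congr rfl h1, ← Finset.mul_sum, Finset.sum_pow_mul_eq_add_pow]
    simp
  · intro S hS S' hS' h
    have hd : ∀ S ∈ (E \ T).powerset, Disjoint T S := fun S hS =>
      Finset.disjoint_of_subset_right (Finset.mem_powerset.1 hS) Finset.disjoint_sdiff
    dsimp only at h
    rw [← Finset.union_sdiff_cancel_left (hd S hS), h,
      Finset.union_sdiff_cancel_left (hd S' hS')]

lemma card_const_on (U : Finset V) (a : Fin k) :
    #{χ : V → Fin k | ∀ v ∈ U, χ v = a} = k ^ (Fintype.card V - U.card) := by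
  have h : ({χ : V → Fin k | ∀ v ∈ U, χ v = a} : Finset _) =
      Fintype.piFinset fun v => if v ∈ U then {a} else Finset.univ := by
    ext χ
    simp only [Finset.mem_filter, Finset.mem_univ, true_and, Fintype.mem_piFinset]
    refine forall_congr' fun v => ?_
    by_cases hv : v ∈ U <;> simp [hv]
  rw [h, Fintype.card_piFinset, ← Finset.card_univ, ← Finset.card_sdiff_of_subset
    (Finset.subset_univ U), ← Finset.prod_const, ← Finset.prod_sdiff (Finset.subset_univ U)]
  rw [Finset.prod_eq_one (s := U) (fun v hv => by simp [hv]), mul_one]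
  refine Finset.prod_congr rfl fun v hv => ?_
  simp [(Finset.mem_sdiff.1 hv).2]

/-- The probability that given edges are sampled and given vertices are in a given part. -/
lemma sampleMean_indicator {T : Finset (Sym2 V)} (hT : T ⊆ E) (U : Finset V) (a : Fin k) :
    sampleMean p k E (fun S χ => if T ⊆ S ∧ ∀ v ∈ U, χ v = a then 1 else 0) =
      p ^ T.card * ((k : ℝ)⁻¹) ^ U.card := by
  have hk : (k : ℝ) ≠ 0 := by
    have := a.pos
    positivity
  have hU : U.card ≤ Fintype.card V := Finset.card_le_univ U
  rw [← sum_bwE_superset hT, Finset.sum_filter, Finset.sum_mul, sampleMean]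
  refine Finset.sum_congr rfl fun S _ => ?_
  by_cases hTS : T ⊆ S
  · simp only [hTS, true_and, if_true]
    rw [← Finset.mul_sum, Finset.sum_boole, card_const_on, mul_assoc]
    congr 1
    push_cast
    rw [pow_sub₀ _ hk hU, inv_pow, inv_mul_cancel_left₀ (pow_ne_zero _ hk)]
  · simp [hTS]

lemma card_partDarts_eq {S : Finset (Sym2 V)} (hS : S ⊆ E) (a : Fin k) (χ : V → Fin k) :
    ((partDarts S fun u => decide (χ u = a)).card : ℝ) =
      ∑ q : V × V with s(q.1, q.2) ∈ E,
        if {s(q.1, q.2)} ⊆ S ∧ ∀ v ∈ ({q.1} : Finset V), χ v = a then 1 else 0 := by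
  rw [Finset.sum_boole, Finset.filter_filter, partDarts]
  congr 2
  ext q
  simp only [Finset.mem_filter, Finset.mem_univ, true_and, decide_eq_true_eq,
    Finset.singleton_subset_iff, Finset.mem_singleton, forall_eq]
  exact ⟨fun h => ⟨hS h.2, h.2, h.1⟩, fun h => ⟨h.2.2, h.2.1⟩⟩

lemma card_callPairs_eq (S : Finset (Sym2 V)) (a : Fin k) (χ : V → Fin k) :
    ((callPairs E S fun u => decide (χ u = a)).card : ℝ) =
      ∑ q : Fin E.card × Fin E.card with EdgeAdj E q.1 q.2,
        if {edgeAt E q.1, edgeAt E q.2} ⊆ S ∧ ∀ v ∈ ends (edgeAt E q.2), χ v = a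
          then 1 else 0 := by
  rw [Finset.sum_boole, Finset.filter_filter, callPairs]
  congr 2
  ext q
  simp only [Finset.mem_filter, Finset.mem_univ, true_and, decide_eq_true_eq, InPart, ends,
    Finset.insert_subset_iff, Finset.singleton_subset_iff, and_assoc]

lemma card_ends_of_not_isDiag {e : Sym2 V} (he : ¬ e.IsDiag) : (ends e).card = 2 := by
  induction e using Sym2.ind with
  | _ a b =>
    rw [← Finset.card_pair (a := a) (b := b) (by simpa using he)]
    congr 1
    ext y
    simp [ends]

lemma card_darts_mem_le {Δ : ℕ} (hΔ : ∀ v : V, (E.filter fun e => v ∈ e).card ≤ Δ) :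
    #{q : V × V | s(q.1, q.2) ∈ E} ≤ Fintype.card V * Δ := by
  rw [Finset.card_filter, Fintype.sum_prod_type_right, ← smul_eq_mul, ← Finset.card_univ]
  refine Finset.sum_le_card_nsmul _ _ _ fun v _ => ?_
  rw [← Finset.card_filter]
  exact card_neighbors_le hΔ v

lemma card_edgeAdj_le {Δ : ℕ} (hΔ : ∀ v : V, (E.filter fun e => v ∈ e).card ≤ Δ) :
    #{q : Fin E.card × Fin E.card | EdgeAdj E q.1 q.2} ≤ Fintype.card V * (Δ * Δ) := by
  have hstar : ∀ v : V, #{i : Fin E.card | v ∈ edgeAt E i} ≤ Δ := by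
    intro v
    refine (Finset.card_le_card_of_injOn (edgeAt E) ?_ (edgeAt_injective E).injOn).trans (hΔ v)
    intro i hi
    have hi : v ∈ edgeAt E i := by simpa using hi
    exact Finset.mem_coe.2 (Finset.mem_filter.2 ⟨edgeAt_mem E i, hi⟩)
  calc _ ≤ ((Finset.univ : Finset V).biUnion fun v =>
        (Finset.univ.filter fun i : Fin E.card => v ∈ edgeAt E i) ×ˢ
          (Finset.univ.filter fun i : Fin E.card => v ∈ edgeAt E i)).card := by
        refine Finset.card_le_card fun q hq => ?_
        obtain ⟨-, -, v, h1, h2⟩ := Finset.mem_filter.1 hq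
        simp only [Finset.mem_biUnion, Finset.mem_univ, true_and, Finset.mem_product,
          Finset.mem_filter]
        exact ⟨v, h1, h2⟩
    _ ≤ _ := by
      refine Finset.card_biUnion_le_card_mul _ _ _ fun v _ => ?_
      rw [Finset.card_product]
      exact Nat.mul_le_mul (hstar v) (hstar v)

lemma sampleMean_card_partDarts_le (hp0 : 0 ≤ p) (hp1 : p ≤ 1) {Δ : ℕ}
    (hΔ : ∀ v : V, (E.filter fun e => v ∈ e).card ≤ Δ) (a : Fin k) :
    sampleMean p k E (fun S χ => ((partDarts S fun u => decide (χ u = a)).card : ℝ)) ≤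
      Fintype.card V * Δ * (p * (k : ℝ)⁻¹) := by
  refine (sampleMean_mono hp0 hp1 fun S hS χ => (card_partDarts_eq hS a χ).le).trans ?_
  rw [sampleMean_sum]
  refine (Finset.sum_le_card_nsmul _ _ (p * (k : ℝ)⁻¹) fun q hq => ?_).trans ?_
  · rw [sampleMean_indicator (Finset.singleton_subset_iff.2 (Finset.mem_filter.1 hq).2)]
    simp
  · rw [nsmul_eq_mul]
    gcongr
    exact_mod_cast card_darts_mem_le hΔ

lemma sampleMean_card_callPairs_le (hp0 : 0 ≤ p) (hp1 : p ≤ 1)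
    (hE : ∀ e ∈ E, ¬ e.IsDiag) {Δ : ℕ}
    (hΔ : ∀ v : V, (E.filter fun e => v ∈ e).card ≤ Δ) (a : Fin k) :
    sampleMean p k E (fun S χ => ((callPairs E S fun u => decide (χ u = a)).card : ℝ)) ≤
      Fintype.card V * (Δ * Δ) * (p ^ 2 * (k : ℝ)⁻¹ ^ 2) := by
  refine (sampleMean_mono hp0 hp1 fun S _ χ => (card_callPairs_eq S a χ).le).trans ?_
  rw [sampleMean_sum]
  refine (Finset.sum_le_card_nsmul _ _ (p ^ 2 * (k : ℝ)⁻¹ ^ 2) fun q hq => ?_).trans ?_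
  · have hne : edgeAt E q.1 ≠ edgeAt E q.2 := fun h =>
      (Finset.mem_filter.1 hq).2.1 (edgeAt_injective E h)
    rw [sampleMean_indicator (by
      simp [Finset.insert_subset_iff, edgeAt_mem]), Finset.card_pair hne,
      card_ends_of_not_isDiag (hE _ (edgeAt_mem E _))]
  · rw [nsmul_eq_mul]
    gcongr
    exact_mod_cast card_edgeAdj_le hΔ

lemma sampleMean_one (a : Fin k) : sampleMean p k E (fun _ _ => 1) = 1 := by
  simpa using sampleMean_indicator (p := p) (E := E) (Finset.empty_subset E) ∅ a

/-- The expected total number of queries, for arbitrary sampling parameters. -/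
lemma sampleMean_sum_Bqueries_le (hp0 : 0 ≤ p) (hp1 : p ≤ 1)
    (hE : ∀ e ∈ E, ¬ e.IsDiag) {Δ : ℕ}
    (hΔ : ∀ v : V, (E.filter fun e => v ∈ e).card ≤ Δ) (a : Fin k) :
    ∑ τ : Equiv.Perm (Fin E.card), sampleMean p k E (fun S χ =>
        ∑ v, (Bqueries E (prioOf E τ) S (fun u => decide (χ u = a)) v : ℝ)) ≤
      (Fintype.card V * Δ + 2 * Δ * (Fintype.card V * Δ * (p * (k : ℝ)⁻¹)) +
        4 * Δ * (Fintype.card V * (Δ * Δ) * (p ^ 2 * (k : ℝ)⁻¹ ^ 2))) *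
        Fintype.card (Equiv.Perm (Fin E.card)) := by
  set N := Fintype.card (Equiv.Perm (Fin E.card)) with hN
  rw [← sampleMean_sum]
  have hpoint : ∀ S ⊆ E, ∀ χ : V → Fin k, ∑ τ : Equiv.Perm (Fin E.card),
      ∑ v, (Bqueries E (prioOf E τ) S (fun u => decide (χ u = a)) v : ℝ) ≤
      N * (Fintype.card V * Δ) * 1 +
        N * (2 * Δ) * ((partDarts S fun u => decide (χ u = a)).card : ℝ) +
        N * (4 * Δ) * ((callPairs E S fun u => decide (χ u = a)).card : ℝ) := by
    intro S hS χ
    set x : V → Bool := fun u => decide (χ u = a)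
    have h1 := Finset.sum_le_sum fun τ (_ : τ ∈ Finset.univ) => sum_Bqueries_le hS hΔ x τ
    have h2 := sum_card_longPaths_le hS x
    simp only [Finset.sum_add_distrib, ← Finset.mul_sum, Finset.sum_const, Finset.card_univ,
      smul_eq_mul, ← hN] at h1
    have h3 := h1.trans (Nat.add_le_add_left (Nat.mul_le_mul_left Δ (Nat.mul_le_mul_left 2
      (Nat.add_le_add_left (Nat.mul_le_mul_left 2 h2) _))) _)
    have h4 := (Nat.cast_le (α := ℝ)).2 h3
    push_cast at h4
    refine h4.trans (le_of_eq ?_)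
    ring
  refine (sampleMean_mono hp0 hp1 hpoint).trans ?_
  rw [sampleMean_add, sampleMean_add, sampleMean_const_mul, sampleMean_const_mul,
    sampleMean_const_mul, sampleMean_one a]
  have h1 := mul_le_mul_of_nonneg_left (sampleMean_card_partDarts_le hp0 hp1 hΔ a)
    (show (0 : ℝ) ≤ N * (2 * Δ) by positivity)
  have h2 := mul_le_mul_of_nonneg_left (sampleMean_card_callPairs_le hp0 hp1 hE hΔ a)
    (show (0 : ℝ) ≤ N * (4 * Δ) by positivity)
  linarith

end SampleMean


universe u

/-- **Expected total number of queried entries** (Lemma 4.7).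
There is a universal constant `C > 0` such that the following holds.  Run Algorithm 1 on an
`n`-vertex graph `G = (V, E)` with maximum degree `Δ` (edge-sampling probability
`p = Δ^{-0.85}`, `k = Δ^{0.1}` parts).  Then `E[ ∑_{v ∈ V} B(v) ] ≤ C·n·Δ^{1.15}`, where
the expectation is over the partition `χ`, the edge sample `L` and the permutation `π`,
and `B(v)` is the number of entries of `x⃗` (the indicator vector of `V₁`) queried during
the execution of `DegreeOracle_π(v, x⃗)`. -/
theorem expected_total_degree_oracle_queries :
    ∃ C : ℝ, 0 < C ∧
      ∀ (V : Type u) [Fintype V] [DecidableEq V]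
        (E : Finset (Sym2 V)) (_ : ∀ e ∈ E, ¬ e.IsDiag)
        (Δ : ℕ) (_ : ∀ v : V, (E.filter fun e => v ∈ e).card ≤ Δ) (_ : 1 ≤ Δ)
        (p : ℝ) (_ : p = (Δ : ℝ) ^ (-(0.85 : ℝ)))
        (k : ℕ) (_ : (k : ℝ) = (Δ : ℝ) ^ ((0.1 : ℝ))) (hk0 : 0 < k),
        (∑ τ : Equiv.Perm (Fin E.card), ∑ S ∈ E.powerset, ∑ χ : V → Fin k,
            bwE p E S * ((k : ℝ) ^ Fintype.card V)⁻¹ *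
              ∑ v : V,
                (Bqueries E (prioOf E τ) S (fun u => decide (χ u = ⟨0, hk0⟩)) v : ℝ)) /
          (Fintype.card (Equiv.Perm (Fin E.card)) : ℝ) ≤
        C * Fintype.card V * (Δ : ℝ) ^ ((1.15 : ℝ)) := by
  refine ⟨7, by norm_num, ?_⟩
  intro V _ _ E hE Δ hΔ hΔ1 p hp k hk hk0
  have hΔ1' : (1 : ℝ) ≤ Δ := by exact_mod_cast hΔ1
  have hΔ0 : (0 : ℝ) < Δ := by linarith
  have hp0 : 0 ≤ p := hp ▸ Real.rpow_nonneg hΔ0.le _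
  have hp1 : p ≤ 1 := hp ▸ Real.rpow_le_one_of_one_le_of_nonpos hΔ1' (by norm_num)
  have hpk : p * (k : ℝ)⁻¹ = (Δ : ℝ) ^ (-(0.95 : ℝ)) := by
    rw [hp, hk, ← Real.rpow_neg hΔ0.le, ← Real.rpow_add hΔ0]
    norm_num
  have hmono : ∀ t : ℝ, t ≤ 1.15 → (Δ : ℝ) ^ t ≤ (Δ : ℝ) ^ (1.15 : ℝ) := fun t ht =>
    Real.rpow_le_rpow_of_exponent_le hΔ1' ht
  have hdeg : (Δ : ℝ) ≤ (Δ : ℝ) ^ (1.15 : ℝ) := by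
    simpa using hmono 1 (by norm_num)
  have hdarts : (Δ : ℝ) * Δ * (p * (k : ℝ)⁻¹) ≤ (Δ : ℝ) ^ (1.15 : ℝ) := by
    rw [hpk, ← pow_two, ← Real.rpow_natCast, ← Real.rpow_add hΔ0]
    exact hmono _ (by norm_num)
  have hpairs : (Δ : ℝ) * (Δ * Δ) * (p ^ 2 * (k : ℝ)⁻¹ ^ 2) ≤ (Δ : ℝ) ^ (1.15 : ℝ) := by
    rw [← mul_pow, hpk, ← pow_two, ← pow_succ', ← Real.rpow_natCast, ← Real.rpow_mul_natCast
      hΔ0.le, ← Real.rpow_add hΔ0]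
    exact hmono _ (by norm_num)
  rw [div_le_iff₀ (by exact_mod_cast Fintype.card_pos)]
  refine (sampleMean_sum_Bqueries_le hp0 hp1 hE hΔ ⟨0, hk0⟩).trans ?_
  gcongr
  have hn : (0 : ℝ) ≤ Fintype.card V := Nat.cast_nonneg _
  have h1 := mul_le_mul_of_nonneg_left hdeg hn
  have h2 := mul_le_mul_of_nonneg_left hdarts hn
  have h3 := mul_le_mul_of_nonneg_left hpairs hn
  linarith
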